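/- Let n be an even positive integer and ξ a complex non-real algebraic number of degree greater than n such that 1, ξ + ξ̄, and ξ·ξ̄ are linearly dependent over ℚ (where ξ̄ is the complex conjugate). Then t_n(ξ) = (n+2)/2. -/

import Mathlib

open Polynomial

/-- The ℚ-vector space of polynomials `f ∈ ℚ[X]` of degree at most `n`
with `μ * f(ξ) ∈ ℝ`. -/
noncomputable def Vspace (n : ℕ) (μ ξ : ℂ) : Submodule ℚ ℚ[X] where
  carrier := {f | f.natDegree ≤ n ∧ ∃ r : ℝ, μ * aeval ξ f = (r : ℂ)}
  zero_mem' := ⟨by simp, 0, by simp⟩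
  add_mem' := by
    rintro f g ⟨hf, r, hr⟩ ⟨hg, s, hs⟩
    refine ⟨(natDegree_add_le f g).trans (by simp [hf, hg]), r + s, ?_⟩
    push_cast
    rw [map_add, mul_add, hr, hs]
  smul_mem' := by
    rintro c f ⟨hf, r, hr⟩
    refine ⟨(natDegree_smul_le c f).trans hf, c * r, ?_⟩
    rw [map_smul, Algebra.mul_smul_comm, hr, Rat.smul_def]
    push_cast
    ring

/-- `t_n(ξ)`: the maximum over nonzero `μ ∈ ℂ` of `dim_ℚ V_n(μ,ξ)`. -/
noncomputable def tdeg (n : ℕ) (ξ : ℂ) : ℕ :=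
  sSup {d : ℕ | ∃ μ : ℂ, μ ≠ 0 ∧ d = Module.finrank ℚ (Vspace n μ ξ)}

lemma Vspace_le (n : ℕ) (μ ξ : ℂ) : Vspace n μ ξ ≤ degreeLT ℚ (n + 1) := by
  intro f hf
  rw [mem_degreeLT]
  exact lt_of_le_of_lt (natDegree_le_iff_degree_le.mp hf.1) (by exact_mod_cast Nat.lt_succ_self n)

lemma Vspace_finite (n : ℕ) (μ ξ : ℂ) : Module.Finite ℚ (Vspace n μ ξ) :=
  Module.Finite.of_injective (Submodule.inclusion (Vspace_le n μ ξ))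
    (Submodule.inclusion_injective _)

lemma Vspace_upper (n : ℕ) (μ ξ : ℂ) (hμ : μ ≠ 0) (hξreal : ξ.im ≠ 0)
    (hdeg : n < (minpoly ℚ ξ).natDegree) :
    2 * Module.finrank ℚ (Vspace n μ ξ) ≤ n + 2 := by
  have := Vspace_finite n μ ξ
  let φ : (Vspace n μ ξ × Vspace n μ ξ) →ₗ[ℚ] ℚ[X] :=
    LinearMap.coprod (Vspace n μ ξ).subtype
      ((LinearMap.mulLeft ℚ (X : ℚ[X])).comp (Vspace n μ ξ).subtype)
  have hφ : ∀ x, φ x = (x.1 : ℚ[X]) + X * (x.2 : ℚ[X]) := fun x => by simp [φ]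
  have hmem : ∀ x, φ x ∈ degreeLT ℚ (n + 2) := by
    intro x
    rw [hφ, mem_degreeLT]
    have h1 := x.1.2.1
    have h2 := x.2.2.1
    have h3 : ((x.1 : ℚ[X]) + X * (x.2 : ℚ[X])).natDegree ≤ n + 1 := by
      refine (natDegree_add_le _ _).trans (max_le (by omega) ?_)
      refine natDegree_mul_le.trans ?_
      have := natDegree_X_le (R := ℚ)
      omega
    exact lt_of_le_of_lt (natDegree_le_iff_degree_le.mp h3)
      (by exact_mod_cast Nat.lt_succ_self (n + 1))
  have hinj : Function.Injective (φ.codRestrict _ hmem) := by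
    rw [injective_iff_map_eq_zero]
    intro x hx
    have hx' : (x.1 : ℚ[X]) + X * (x.2 : ℚ[X]) = 0 := by
      rw [← hφ]
      exact congrArg Subtype.val hx
    obtain ⟨⟨f, hfd, r, hr⟩, ⟨g, hgd, s, hs⟩⟩ := x
    simp only at hx'
    have hf : f = -(X * g) := eq_neg_of_add_eq_zero_left hx'
    have h1 : aeval ξ f = -(ξ * aeval ξ g) := by rw [hf]; simp
    have h2 : (r : ℂ) = -(ξ * s) := by rw [← hr, ← hs, h1]; ring
    have h3 : s = 0 := by
      have := congrArg Complex.im h2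
      simp at this
      tauto
    have h4 : aeval ξ g = 0 := by
      rw [h3] at hs
      simpa [hμ] using hs
    have hg : g = 0 := by
      by_contra hg
      have := natDegree_le_natDegree (minpoly.degree_le_of_ne_zero ℚ ξ hg h4)
      omega
    subst hg
    have hf0 : f = 0 := by simpa using hf
    subst hf0
    rfl
  have h := LinearMap.finrank_le_finrank_of_injective hinj
  rw [Module.finrank_prod, Module.finrank_eq_card_basis (degreeLT.basis ℚ (n + 2)),
    Fintype.card_fin] at h
  omega

lemma li_of_degree {m : ℕ} (f : Fin m → ℚ[X]) (h0 : ∀ i, f i ≠ 0)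
    (hd : Function.Injective fun i => (f i).natDegree) : LinearIndependent ℚ f := by
  rw [Fintype.linearIndependent_iff]
  intro c hc i
  have h := degree_sum_eq_of_disjoint (fun i => c i • f i) Finset.univ (by
    rintro a ⟨-, ha⟩ b ⟨-, hb⟩ hab
    have ha' : c a ≠ 0 := fun h => ha (by simp [h])
    have hb' : c b ≠ 0 := fun h => hb (by simp [h])
    simp only [Function.onFun, Function.comp]
    intro h
    have h := natDegree_eq_of_degree_eq h
    rw [natDegree_smul _ ha', natDegree_smul _ hb'] at h
    exact hab (hd h))
  rw [hc, degree_zero] at h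
  have h1 : degree (c i • f i) ≤ ⊥ := h ▸ Finset.le_sup (f := fun i => degree (c i • f i))
    (Finset.mem_univ i)
  have h2 : c i • f i = 0 := degree_eq_bot.mp (le_bot_iff.mp h1)
  exact (smul_eq_zero.mp h2).resolve_right (h0 i)

lemma Vspace_lower (k : ℕ) (ξ : ℂ) (p q : ℚ[X]) (hp : p.natDegree = 2) (hq : q.natDegree < 2)
    (hq0 : aeval ξ q ≠ 0) (r : ℝ) (hr : aeval ξ p = r * aeval ξ q) :
    k + 1 ≤ Module.finrank ℚ (Vspace (2 * k) ((aeval ξ q) ^ k)⁻¹ ξ) := by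
  have hp' : p ≠ 0 := by rintro rfl; simp at hp
  have hq' : q ≠ 0 := by rintro rfl; simp at hq0
  have := Vspace_finite (2 * k) ((aeval ξ q) ^ k)⁻¹ ξ
  have hdeg : ∀ j : ℕ, (p ^ j * q ^ (k - j)).natDegree = j * 2 + (k - j) * q.natDegree := by
    intro j
    rw [natDegree_mul (pow_ne_zero _ hp') (pow_ne_zero _ hq'), natDegree_pow, natDegree_pow, hp]
  have hmem : ∀ j : Fin (k + 1), p ^ (j : ℕ) * q ^ (k - j) ∈
      Vspace (2 * k) ((aeval ξ q) ^ k)⁻¹ ξ := by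
    rintro ⟨j, hj⟩
    refine ⟨?_, r ^ j, ?_⟩
    · rw [hdeg]
      have : (k - j) * q.natDegree ≤ (k - j) * 1 := Nat.mul_le_mul_left _ (by omega)
      simp only at this ⊢
      omega
    · have hk : (aeval ξ q) ^ k = (aeval ξ q) ^ j * (aeval ξ q) ^ (k - j) := by
        rw [← pow_add]; congr 1; omega
      rw [map_mul, map_pow, map_pow, hr, hk, mul_pow]
      push_cast
      field_simp
  have hli : LinearIndependent ℚ (fun j : Fin (k + 1) => p ^ (j : ℕ) * q ^ (k - j)) := by
    apply li_of_degree
    · intro i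
      exact mul_ne_zero (pow_ne_zero _ hp') (pow_ne_zero _ hq')
    · rintro ⟨a, ha⟩ ⟨b, hb⟩ hab
      simp only [hdeg] at hab
      ext
      have : q.natDegree = 0 ∨ q.natDegree = 1 := by omega
      rcases this with h | h <;> rw [h] at hab <;> simp only at hab ⊢ <;> omega
  have hli' : LinearIndependent ℚ
      (fun j : Fin (k + 1) => (⟨_, hmem j⟩ : Vspace (2 * k) ((aeval ξ q) ^ k)⁻¹ ξ)) :=
    LinearIndependent.of_comp (Submodule.subtype _) hli
  simpa using hli'.fintype_card_le_finrank

lemma exists_pq (ξ : ℂ) (hξreal : ξ.im ≠ 0)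
    (hdep : ∃ a b c : ℚ, ¬(a = 0 ∧ b = 0 ∧ c = 0) ∧
      (a : ℂ) + (b : ℂ) * (ξ + (starRingEnd ℂ) ξ)
        + (c : ℂ) * (ξ * (starRingEnd ℂ) ξ) = 0) :
    ∃ p q : ℚ[X], p.natDegree = 2 ∧ q.natDegree < 2 ∧ aeval ξ q ≠ 0 ∧
      ∃ r : ℝ, aeval ξ p = r * aeval ξ q := by
  obtain ⟨a, b, c, hne, h⟩ := hdep
  have hre : (a : ℝ) + b * (2 * ξ.re) + c * (ξ.re ^ 2 + ξ.im ^ 2) = 0 := by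
    have := congrArg Complex.re h
    simp at this
    linarith
  by_cases hc : c = 0
  · subst hc
    have hb : b ≠ 0 := by
      rintro rfl
      apply hne
      simpa using hre
    have hbR : (b : ℝ) ≠ 0 := by exact_mod_cast hb
    have hx : ξ.re = - (a / (2 * b)) := by
      field_simp
      push_cast at hre
      linarith
    obtain ⟨e, he⟩ : ∃ e : ℚ, e = a / (2 * b) := ⟨_, rfl⟩
    have hx' : ξ.re = -(e : ℝ) := by rw [hx, he]; push_cast; ring
    refine ⟨(X + C e) ^ 2, 1, ?_, by simp, by simp, -(ξ.im ^ 2), ?_⟩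
    · rw [natDegree_pow, natDegree_X_add_C]
    · have : aeval ξ (X + C e) = ξ.im * Complex.I := by
        apply Complex.ext <;> simp [hx']
      rw [map_pow, this, mul_pow, Complex.I_sq]
      simp
  · have hcR : (c : ℝ) ≠ 0 := by exact_mod_cast hc
    set d : ℚ := b / c with hd
    set N : ℚ := d ^ 2 - a / c with hN
    have hNR : (N : ℝ) = (ξ.re + d) ^ 2 + ξ.im ^ 2 := by
      rw [hN, hd]
      push_cast
      field_simp
      linear_combination (-(c : ℝ)) * hre
    have hη : aeval ξ (X + C d) = ξ + d := by simp
    refine ⟨(X + C d) ^ 2 + C N, X + C d, ?_, ?_, ?_, 2 * (ξ.re + d), ?_⟩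
    · rw [natDegree_add_C, natDegree_pow, natDegree_X_add_C]
    · rw [natDegree_X_add_C]; norm_num
    · rw [hη]
      intro h0
      apply hξreal
      simpa using congrArg Complex.im h0
    · rw [map_add, map_pow, hη]
      have h1 : aeval ξ (C N) = ((N : ℝ) : ℂ) := by simp
      rw [h1, hNR]
      apply Complex.ext
      · simp [pow_two]
        ring
      · simp [pow_two]
        ring

theorem tdeg_of_lin_dep_trace_norm (n : ℕ) (hn : 0 < n) (hne : Even n) (ξ : ℂ)
    (hξreal : ξ.im ≠ 0) (hξalg : IsAlgebraic ℚ ξ)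
    (hdeg : n < (minpoly ℚ ξ).natDegree)
    (hdep : ∃ a b c : ℚ, ¬(a = 0 ∧ b = 0 ∧ c = 0) ∧
      (a : ℂ) + (b : ℂ) * (ξ + (starRingEnd ℂ) ξ)
        + (c : ℂ) * (ξ * (starRingEnd ℂ) ξ) = 0) :
    2 * tdeg n ξ = n + 2 := by
  obtain ⟨k, hk⟩ := hne
  obtain rfl : n = 2 * k := by omega
  obtain ⟨p, q, hp, hq, hq0, r, hr⟩ := exists_pq ξ hξreal hdep
  have hlow := Vspace_lower k ξ p q hp hq hq0 r hr
  have hub : ∀ d ∈ {d : ℕ | ∃ μ : ℂ, μ ≠ 0 ∧ d = Module.finrank ℚ (Vspace (2 * k) μ ξ)},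
      d ≤ k + 1 := by
    rintro d ⟨μ, hμ, rfl⟩
    have := Vspace_upper (2 * k) μ ξ hμ hξreal hdeg
    omega
  have hin : Module.finrank ℚ (Vspace (2 * k) ((aeval ξ q) ^ k)⁻¹ ξ) ∈
      {d : ℕ | ∃ μ : ℂ, μ ≠ 0 ∧ d = Module.finrank ℚ (Vspace (2 * k) μ ξ)} :=
    ⟨_, inv_ne_zero (pow_ne_zero _ hq0), rfl⟩
  have h1 : tdeg (2 * k) ξ ≤ k + 1 := csSup_le ⟨_, hin⟩ hub
  have h2 : k + 1 ≤ tdeg (2 * k) ξ := hlow.trans (le_csSup ⟨k + 1, hub⟩ hin)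
  omega
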